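/- Let X be a complex m×n matrix with ‖X‖_S = 1. Then there exist a positive semidefinite m×m matrix F with every diagonal entry of F² equal to 1, a positive semidefinite n×n matrix G with every diagonal entry of G² equal to 1, and a complex m×n matrix C with ‖C‖∞ = 1, such that X = F C G. -/

import Mathlib

open Matrix
open scoped ComplexOrder

noncomputable section

namespace MatFact

/-- ℓ² norm of a complex vector. -/
def vnorm {n : ℕ} (v : Fin n → ℂ) : ℝ := Real.sqrt (∑ j, ‖v j‖ ^ 2)

/-- Operator norm of a matrix as a map ℓ²(Fin n) → ℓ²(Fin m). -/
def opNorm {m n : ℕ} (X : Matrix (Fin m) (Fin n) ℂ) : ℝ :=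
  sSup {c : ℝ | ∃ v : Fin n → ℂ, vnorm v ≤ 1 ∧ c = vnorm (X.mulVec v)}

/-- Column norm: the maximal ℓ² norm of a column. -/
def colNorm {m n : ℕ} (X : Matrix (Fin m) (Fin n) ℂ) : ℝ :=
  ⨆ j : Fin n, vnorm (fun i => X i j)

/-- Hilbert–Schmidt (Frobenius) norm. -/
def frobNorm {m n : ℕ} (X : Matrix (Fin m) (Fin n) ℂ) : ℝ :=
  Real.sqrt (∑ i, ∑ j, ‖X i j‖ ^ 2)

/-- Schur norm: operator norm of Schur (entrywise) multiplication by `X`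
on matrices with the operator norm. -/
def schurNorm {m n : ℕ} (X : Matrix (Fin m) (Fin n) ℂ) : ℝ :=
  sSup {c : ℝ | ∃ A : Matrix (Fin m) (Fin n) ℂ, opNorm A ≤ 1 ∧
    c = opNorm (Matrix.hadamard X A)}

/-- The T-norm (bilinear Schur norm). -/
def Tnorm {m n : ℕ} (X : Matrix (Fin m) (Fin n) ℂ) : ℝ :=
  sSup {c : ℝ | ∃ (a : Fin m → ℂ) (B : Matrix (Fin m) (Fin n) ℂ),
    (∀ i, ‖a i‖ ≤ 1) ∧ opNorm B ≤ 1 ∧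
    c = vnorm (fun j => ∑ i, a i * X i j * B i j)}

/-- The F-norm: operator norm of `X` from `ℂⁿ` with the sup norm to `ℂᵐ`
with the ℓ² norm. -/
def Fnorm {m n : ℕ} (X : Matrix (Fin m) (Fin n) ℂ) : ℝ :=
  sSup {c : ℝ | ∃ v : Fin n → ℂ, (∀ j, ‖v j‖ ≤ 1) ∧ c = vnorm (X.mulVec v)}

/-- The bilinear form norm. -/
def Bnorm {m n : ℕ} (Y : Matrix (Fin m) (Fin n) ℂ) : ℝ :=
  sSup {c : ℝ | ∃ (a : Fin m → ℂ) (b : Fin n → ℂ), (∀ i, ‖a i‖ ≤ 1) ∧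
    (∀ j, ‖b j‖ ≤ 1) ∧ c = ‖∑ i, ∑ j, Y i j * a i * b j‖}

/-- The completely bounded F-norm. -/
def cbF {m n : ℕ} (X : Matrix (Fin m) (Fin n) ℂ) : ℝ :=
  sInf {c : ℝ | ∃ (A : Matrix (Fin m) (Fin n) ℂ) (ξ : Fin n → ℂ),
    X = A * Matrix.diagonal ξ ∧ c = opNorm A * vnorm ξ}

/-- The completely bounded bilinear form norm. -/
def cbB {m n : ℕ} (X : Matrix (Fin m) (Fin n) ℂ) : ℝ :=
  sInf {c : ℝ | ∃ (η : Fin m → ℂ) (B : Matrix (Fin m) (Fin n) ℂ) (ξ : Fin n → ℂ),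
    X = Matrix.diagonal η * B * Matrix.diagonal ξ ∧
    c = vnorm η * opNorm B * vnorm ξ}

/-- The range (column space) of a matrix, as a submodule of `ℂᵐ`. -/
def ran {m n : ℕ} (X : Matrix (Fin m) (Fin n) ℂ) : Submodule ℂ (Fin m → ℂ) :=
  LinearMap.range X.mulVecLin

/-- `P` is the orthogonal projection onto the subspace `E`, i.e. `P` is a
Hermitian idempotent with range `E`. -/
def IsOrthProjOnto {n : ℕ} (P : Matrix (Fin n) (Fin n) ℂ)
    (E : Submodule ℂ (Fin n → ℂ)) : Prop :=
  P.IsHermitian ∧ P * P = P ∧ ran P = E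

/-- `W` is a partial isometry with support `E` and range `F`. -/
def IsPartialIsometryFromTo {m n : ℕ} (W : Matrix (Fin m) (Fin n) ℂ)
    (E : Submodule ℂ (Fin n → ℂ)) (F : Submodule ℂ (Fin m → ℂ)) : Prop :=
  IsOrthProjOnto (Wᴴ * W) E ∧ IsOrthProjOnto (W * Wᴴ) F

/-- A cb operator factorization of `X`. -/
def IsCbOpFact {m n : ℕ} (X A : Matrix (Fin m) (Fin n) ℂ) (ξ : Fin n → ℂ) : Prop :=
  (∀ j, 0 ≤ ξ j) ∧ vnorm ξ = 1 ∧ opNorm A = cbF X ∧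
  (∀ j, ξ j = 0 → ∀ i, A i j = 0) ∧ X = A * Matrix.diagonal ξ

/-- A cb bilinear form factorization of `X`. -/
def IsCbBilFact {m n : ℕ} (X : Matrix (Fin m) (Fin n) ℂ) (η : Fin m → ℂ)
    (B : Matrix (Fin m) (Fin n) ℂ) (ξ : Fin n → ℂ) : Prop :=
  (∀ i, 0 ≤ η i) ∧ (∀ j, 0 ≤ ξ j) ∧ vnorm η = 1 ∧ vnorm ξ = 1 ∧
  opNorm B = cbB X ∧ (∀ j, ξ j = 0 → ∀ i, B i j = 0) ∧
  (∀ i, η i = 0 → ∀ j, B i j = 0) ∧ X = Matrix.diagonal η * B * Matrix.diagonal ξ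

/-- A Schur factorization of `X`. -/
def IsSchurFact {m n : ℕ} (X : Matrix (Fin m) (Fin n) ℂ)
    (F : Matrix (Fin m) (Fin m) ℂ) (W : Matrix (Fin m) (Fin n) ℂ)
    (G : Matrix (Fin n) (Fin n) ℂ) : Prop :=
  F.PosSemidef ∧ (∀ i, (F * F) i i ≤ 1) ∧ G.PosSemidef ∧ (∀ j, (G * G) j j ≤ 1) ∧
  IsPartialIsometryFromTo W (ran G) (ran F) ∧
  X = (schurNorm X : ℂ) • (F * W * G)

/-- A bilinear Schur factorization of `X`. -/
def IsBilinSchurFact {m n : ℕ} (X : Matrix (Fin m) (Fin n) ℂ)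
    (T : Matrix (Fin m) (Fin m) ℂ) (W : Matrix (Fin m) (Fin n) ℂ)
    (G : Matrix (Fin n) (Fin n) ℂ) : Prop :=
  T.PosSemidef ∧ frobNorm T = Tnorm X ∧ G.PosSemidef ∧ (∀ j, (G * G) j j ≤ 1) ∧
  IsPartialIsometryFromTo W (ran G) (ran T) ∧ X = T * W * G

/-- Maximal diagonal entry (real part) of a square matrix. -/
def maxDiag {n : ℕ} (P : Matrix (Fin n) (Fin n) ℂ) : ℝ := ⨆ i, (P i i).re

end MatFact

namespace MatFact

lemma vnorm_sq {n : ℕ} (v : Fin n → ℂ) : vnorm v ^ 2 = ∑ j, ‖v j‖ ^ 2 :=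
  Real.sq_sqrt (Finset.sum_nonneg fun _ _ => by positivity)

lemma vnorm_nonneg {n : ℕ} (v : Fin n → ℂ) : 0 ≤ vnorm v := Real.sqrt_nonneg _

section L2Operator

open scoped Matrix.Norms.L2Operator

lemma vnorm_eq_norm {n : ℕ} (v : Fin n → ℂ) : vnorm v = ‖WithLp.toLp 2 v‖ := by
  rw [EuclideanSpace.norm_eq]; rfl

lemma opNorm_eq_norm {m n : ℕ} (A : Matrix (Fin m) (Fin n) ℂ) : opNorm A = ‖A‖ := by
  rw [Matrix.l2_opNorm_def, ← ContinuousLinearMap.sSup_unitClosedBall_eq_norm]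
  unfold opNorm
  congr 1
  ext c
  constructor
  · rintro ⟨v, hv, rfl⟩
    refine ⟨WithLp.toLp 2 v, ?_, ?_⟩
    · rw [vnorm_eq_norm] at hv
      simpa using hv
    · rw [vnorm_eq_norm]; rfl
  · rintro ⟨v, hv, rfl⟩
    refine ⟨v.ofLp, ?_, ?_⟩
    · rw [vnorm_eq_norm]
      simpa using hv
    · rw [vnorm_eq_norm]; rfl

lemma opNorm_nonneg {m n : ℕ} (A : Matrix (Fin m) (Fin n) ℂ) : 0 ≤ opNorm A := by
  rw [opNorm_eq_norm]; exact norm_nonneg _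

lemma sum_norm_mulVec_sq_le {m n : ℕ} (A : Matrix (Fin m) (Fin n) ℂ) (v : Fin n → ℂ) :
    ∑ i, ‖(A *ᵥ v) i‖ ^ 2 ≤ opNorm A ^ 2 * ∑ j, ‖v j‖ ^ 2 := by
  rw [← vnorm_sq, ← vnorm_sq, ← mul_pow]
  refine pow_le_pow_left₀ (vnorm_nonneg _) ?_ 2
  rw [vnorm_eq_norm, vnorm_eq_norm, opNorm_eq_norm]
  exact Matrix.l2_opNorm_mulVec A (WithLp.toLp 2 v)

/-- The positive part of a polar decomposition, with a contraction in place of the partial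
isometry. -/
lemma exists_posSemidef_contraction {p m : Type*} [Fintype p] [DecidableEq p] [Fintype m]
    [DecidableEq m] (R : Matrix p m ℂ) :
    ∃ (F : Matrix m m ℂ) (U : Matrix p m ℂ),
      F.PosSemidef ∧ F * F = Rᴴ * R ∧ R = U * F ∧ ‖U‖ ≤ 1 := by
  have hA : (Rᴴ * R).PosSemidef := Matrix.posSemidef_conjTranspose_mul_self R
  have hnn := hA.eigenvalues_nonneg
  have hspec := hA.1.spectral_theorem
  set d := hA.1.eigenvalues with hd
  set V : Matrix m m ℂ := (hA.1.eigenvectorUnitary : Matrix m m ℂ) with hV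
  have hVV : Vᴴ * V = 1 := (Matrix.mem_unitaryGroup_iff'.1 hA.1.eigenvectorUnitary.2)
  have hVV' : V * Vᴴ = 1 := (Matrix.mem_unitaryGroup_iff.1 hA.1.eigenvectorUnitary.2)
  have hspec' : Rᴴ * R = V * diagonal (fun i => (d i : ℂ)) * Vᴴ := by
    rw [hspec, Unitary.conjStarAlgAut_apply]; rfl
  have hT : (R * V)ᴴ * (R * V) = diagonal (fun i => (d i : ℂ)) := by
    rw [conjTranspose_mul]
    calc Vᴴ * Rᴴ * (R * V) = Vᴴ * (Rᴴ * R) * V := by simp only [Matrix.mul_assoc]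
      _ = (Vᴴ * V) * diagonal (fun i => (d i : ℂ)) * (Vᴴ * V) := by
        rw [hspec']; simp only [Matrix.mul_assoc]
      _ = _ := by rw [hVV]; simp
  set T := R * V with hTdef
  set s : m → ℂ := fun i => ((Real.sqrt (d i) : ℝ) : ℂ) with hs
  have hss : ∀ i, s i * s i = d i := fun i => by
    simp only [hs]; rw [← Complex.ofReal_mul, Real.mul_self_sqrt (hnn i)]
  have hR : R = T * Vᴴ := by rw [hTdef, Matrix.mul_assoc, hVV', Matrix.mul_one]
  have hTe : T * diagonal (fun i => (s i)⁻¹ * s i) = T := by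
    ext k i
    rw [mul_diagonal]
    by_cases h : s i = 0
    · have h0 : (Tᴴ * T) i i = 0 := by
        rw [hT, diagonal_apply_eq, ← hss, h, zero_mul]
      have : T k i = 0 := by
        rw [mul_apply] at h0
        simp only [conjTranspose_apply] at h0
        have := (Finset.sum_eq_zero_iff_of_nonneg
          (fun k _ => star_mul_self_nonneg (T k i))).1 h0 k (Finset.mem_univ _)
        simpa using this
      rw [this, zero_mul]
    · rw [inv_mul_cancel₀ h, mul_one]
  refine ⟨V * diagonal s * Vᴴ, T * diagonal (fun i => (s i)⁻¹) * Vᴴ, ?_, ?_, ?_, ?_⟩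
  · refine (Matrix.PosSemidef.diagonal ?_).mul_mul_conjTranspose_same V
    intro i
    simp [hs]
  · calc V * diagonal s * Vᴴ * (V * diagonal s * Vᴴ)
        = V * diagonal s * (Vᴴ * V) * diagonal s * Vᴴ := by simp only [Matrix.mul_assoc]
      _ = V * (diagonal s * diagonal s) * Vᴴ := by
        rw [hVV, Matrix.mul_one, Matrix.mul_assoc V]
      _ = _ := by rw [diagonal_mul_diagonal, hspec']; simp only [hss]
  · calc R = T * diagonal (fun i => (s i)⁻¹ * s i) * Vᴴ := by rw [hTe, ← hR]
      _ = T * diagonal (fun i => (s i)⁻¹) * (Vᴴ * V) * diagonal s * Vᴴ := by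
        rw [hVV, Matrix.mul_one, Matrix.mul_assoc T (diagonal _) (diagonal s),
          diagonal_mul_diagonal]
      _ = _ := by simp only [Matrix.mul_assoc]
  · have hVn : ‖Vᴴ‖ ≤ 1 := by
      have := Matrix.l2_opNorm_conjTranspose_mul_self (Vᴴ)
      rw [conjTranspose_conjTranspose, hVV', ← diagonal_one, Matrix.l2_opNorm_diagonal] at this
      have h1 : ‖(1 : m → ℂ)‖ ≤ 1 := (pi_norm_le_iff_of_nonneg zero_le_one).2 (by simp)
      have h2 : ‖Vᴴ‖ * ‖Vᴴ‖ ≤ 1 := this ▸ h1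
      nlinarith [norm_nonneg Vᴴ]
    have hTn : ‖T * diagonal (fun i => (s i)⁻¹)‖ ≤ 1 := by
      have := Matrix.l2_opNorm_conjTranspose_mul_self (T * diagonal (fun i => (s i)⁻¹))
      rw [conjTranspose_mul, Matrix.mul_assoc, ← Matrix.mul_assoc Tᴴ, hT, diagonal_conjTranspose,
        diagonal_mul_diagonal, diagonal_mul_diagonal, Matrix.l2_opNorm_diagonal] at this
      have h1 : ‖fun i => star (fun i => (s i)⁻¹) i * ((d i : ℂ) * (s i)⁻¹)‖ ≤ 1 := by
        refine (pi_norm_le_iff_of_nonneg zero_le_one).2 fun i => ?_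
        rw [← hss]
        by_cases h : s i = 0
        · simp [h]
        · simp [h]
      rw [this] at h1
      nlinarith [norm_nonneg (T * diagonal (fun i => (s i)⁻¹))]
    calc _ ≤ _ := Matrix.l2_opNorm_mul _ _
      _ ≤ 1 := mul_le_one₀ hTn (norm_nonneg _) hVn

/-- The off-diagonal block `Rᴴ * S` of a Gram matrix factors, with a contraction in the middle,
through the square roots of the diagonal blocks `Rᴴ * R` and `Sᴴ * S`. -/
lemma exists_factorization {p : Type*} [Fintype p] [DecidableEq p] {m n : ℕ}
    (R : Matrix p (Fin m) ℂ) (S : Matrix p (Fin n) ℂ) :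
    ∃ (F : Matrix (Fin m) (Fin m) ℂ) (C : Matrix (Fin m) (Fin n) ℂ)
      (G : Matrix (Fin n) (Fin n) ℂ),
      F.PosSemidef ∧ F * F = Rᴴ * R ∧ G.PosSemidef ∧ G * G = Sᴴ * S ∧
      opNorm C ≤ 1 ∧ Rᴴ * S = F * C * G := by
  obtain ⟨F, U, hF, hFF, hR, hU⟩ := exists_posSemidef_contraction R
  obtain ⟨G, W, hG, hGG, hS, hW⟩ := exists_posSemidef_contraction S
  refine ⟨F, Uᴴ * W, G, hF, hFF, hG, hGG, ?_, ?_⟩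
  · rw [opNorm_eq_norm]
    calc _ ≤ _ := Matrix.l2_opNorm_mul _ _
      _ ≤ 1 := mul_le_one₀ (by rwa [Matrix.l2_opNorm_conjTranspose]) (norm_nonneg _) hW
  · conv_lhs => rw [hR, hS, conjTranspose_mul, hF.1.eq]
    simp only [Matrix.mul_assoc]

end L2Operator

lemma opNorm_le_of_sum_sq_le {m n : ℕ} {A : Matrix (Fin m) (Fin n) ℂ} {c : ℝ} (hc : 0 ≤ c)
    (h : ∀ v : Fin n → ℂ, ∑ i, ‖(A *ᵥ v) i‖ ^ 2 ≤ c ^ 2 * ∑ j, ‖v j‖ ^ 2) : opNorm A ≤ c := by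
  refine Real.sSup_le ?_ hc
  rintro _ ⟨v, hv, rfl⟩
  have h1 := h v
  rw [← vnorm_sq, ← vnorm_sq, ← mul_pow] at h1
  exact (abs_le_of_sq_le_sq' h1 (mul_nonneg hc (vnorm_nonneg v))).2.trans
    (mul_le_of_le_one_right hc hv)

lemma sum_norm_sq_row_of_mul_self {m : ℕ} {F : Matrix (Fin m) (Fin m) ℂ} (hF : F.IsHermitian)
    {i : Fin m} (h : (F * F) i i = 1) : ∑ k, ‖F i k‖ ^ 2 = 1 := by
  have h1 : (F * F) i i = ((∑ k, ‖F i k‖ ^ 2 : ℝ) : ℂ) := by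
    rw [mul_apply]
    push_cast
    refine Finset.sum_congr rfl fun k _ => ?_
    rw [← hF.apply k i, ← Complex.mul_conj']
    rfl
  rw [h] at h1
  exact_mod_cast h1.symm

lemma opNorm_hadamard_le {m n : ℕ} {F : Matrix (Fin m) (Fin m) ℂ} {C : Matrix (Fin m) (Fin n) ℂ}
    {G : Matrix (Fin n) (Fin n) ℂ} (hF : ∀ i, ∑ k, ‖F i k‖ ^ 2 = 1)
    (hG : ∀ j, ∑ l, ‖G l j‖ ^ 2 = 1) (A : Matrix (Fin m) (Fin n) ℂ) :
    opNorm (Matrix.hadamard (F * C * G) A) ≤ opNorm C * opNorm A := by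
  refine opNorm_le_of_sum_sq_le (mul_nonneg (opNorm_nonneg C) (opNorm_nonneg A)) fun v => ?_
  set z : Fin n → Fin m → ℂ := fun j => C *ᵥ fun l => G l j * v j with hz
  set t : Fin m → Fin m → ℂ := fun k => A *ᵥ fun j => z j k with ht
  have hout : ∀ i, ((Matrix.hadamard (F * C * G) A) *ᵥ v) i = ∑ k, F i k * t k i := by
    intro i
    simp only [ht, hz, mulVec, dotProduct, hadamard_apply, mul_apply, Finset.sum_mul,
      Finset.mul_sum]
    rw [Finset.sum_comm (s := (Finset.univ : Finset (Fin m)))]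
    refine Finset.sum_congr rfl fun j _ => ?_
    rw [Finset.sum_comm (s := (Finset.univ : Finset (Fin m)))]
    refine Finset.sum_congr rfl fun l _ => Finset.sum_congr rfl fun k _ => ?_
    ring
  have h1 : ∀ i, ‖((Matrix.hadamard (F * C * G) A) *ᵥ v) i‖ ^ 2 ≤ ∑ k, ‖t k i‖ ^ 2 := by
    intro i
    rw [hout]
    calc ‖∑ k, F i k * t k i‖ ^ 2 ≤ (∑ k, ‖F i k‖ * ‖t k i‖) ^ 2 := by
          refine pow_le_pow_left₀ (norm_nonneg _) ((norm_sum_le _ _).trans_eq ?_) 2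
          simp only [norm_mul]
      _ ≤ (∑ k, ‖F i k‖ ^ 2) * ∑ k, ‖t k i‖ ^ 2 := Finset.sum_mul_sq_le_sq_mul_sq _ _ _
      _ = _ := by rw [hF, one_mul]
  calc ∑ i, ‖((Matrix.hadamard (F * C * G) A) *ᵥ v) i‖ ^ 2
      ≤ ∑ i, ∑ k, ‖t k i‖ ^ 2 := Finset.sum_le_sum fun i _ => h1 i
    _ = ∑ k, ∑ i, ‖t k i‖ ^ 2 := Finset.sum_comm
    _ ≤ ∑ k, opNorm A ^ 2 * ∑ j, ‖z j k‖ ^ 2 :=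
      Finset.sum_le_sum fun k _ => sum_norm_mulVec_sq_le A _
    _ = opNorm A ^ 2 * ∑ j, ∑ k, ‖z j k‖ ^ 2 := by rw [← Finset.mul_sum, Finset.sum_comm]
    _ ≤ opNorm A ^ 2 * ∑ j, opNorm C ^ 2 * ∑ l, ‖G l j * v j‖ ^ 2 := by
      gcongr with j
      exact sum_norm_mulVec_sq_le C _
    _ = _ := by
      simp only [norm_mul, mul_pow, ← Finset.sum_mul, hG, one_mul, ← Finset.mul_sum]
      ring

lemma opNorm_hadamard_le_schurNorm {m n : ℕ} {X : Matrix (Fin m) (Fin n) ℂ}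
    (hX : schurNorm X ≠ 0) {A : Matrix (Fin m) (Fin n) ℂ} (hA : opNorm A ≤ 1) :
    opNorm (Matrix.hadamard X A) ≤ schurNorm X := by
  refine le_csSup ?_ ⟨A, hA, rfl⟩
  by_contra h
  exact hX (Real.sSup_of_not_bddAbove h)

/-- A bilinear form dominated by diagonal quadratic forms pairs with `X` to at most the sum of
the weights. -/
lemma re_pairing_le_of_pos {m n : ℕ} {X Y : Matrix (Fin m) (Fin n) ℂ} (hX : schurNorm X = 1)
    {a : Fin m → ℝ} {b : Fin n → ℝ} (ha : ∀ i, 0 < a i) (hb : ∀ j, 0 < b j)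
    (h : ∀ (u : Fin m → ℂ) (v : Fin n → ℂ), (∑ i, ∑ j, Y i j * (u i * v j)).re ≤
      ∑ i, a i * ‖u i‖ ^ 2 + ∑ j, b j * ‖v j‖ ^ 2) :
    (∑ i, ∑ j, Y i j * X i j).re ≤ ∑ i, a i + ∑ j, b j := by
  set α : Fin m → ℂ := fun i => ((Real.sqrt (a i) : ℝ) : ℂ) with hα
  set β : Fin n → ℂ := fun j => ((Real.sqrt (b j) : ℝ) : ℂ) with hβ
  have hαn : ∀ i, ‖α i‖ ^ 2 = a i := fun i => by
    rw [hα, Complex.norm_real, Real.norm_eq_abs, sq_abs, Real.sq_sqrt (ha i).le]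
  have hβn : ∀ j, ‖β j‖ ^ 2 = b j := fun j => by
    rw [hβ, Complex.norm_real, Real.norm_eq_abs, sq_abs, Real.sq_sqrt (hb j).le]
  have hα0 : ∀ i, α i ≠ 0 := fun i h0 => (ha i).ne' (by rw [← hαn, h0]; simp)
  have hβ0 : ∀ j, β j ≠ 0 := fun j h0 => (hb j).ne' (by rw [← hβn, h0]; simp)
  obtain ⟨B, hB⟩ : ∃ B : Matrix (Fin m) (Fin n) ℂ, ∀ i j, B i j = Y i j / (2 * α i * β j) :=
    ⟨of fun i j => Y i j / (2 * α i * β j), fun _ _ => rfl⟩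
  have hBn : opNorm B ≤ 1 := by
    refine opNorm_le_of_sum_sq_le zero_le_one fun v => ?_
    set y := B *ᵥ v with hy
    have h1 := h (fun i => star (y i) / α i) (fun j => v j / β j)
    have h2 : ∑ i, ∑ j, Y i j * (star (y i) / α i * (v j / β j))
        = ((2 * ∑ i, ‖y i‖ ^ 2 : ℝ) : ℂ) := by
      push_cast
      rw [Finset.mul_sum]
      refine Finset.sum_congr rfl fun i _ => ?_
      rw [← Complex.conj_mul']
      have hyi : y i = ∑ j, Y i j / (2 * α i * β j) * v j := by
        simp only [hy, mulVec, dotProduct, hB]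
      rw [← mul_assoc]
      nth_rewrite 3 [hyi]
      rw [Finset.mul_sum]
      refine Finset.sum_congr rfl fun j _ => ?_
      have := hα0 i
      have := hβ0 j
      rw [show star (y i) = (starRingEnd ℂ) (y i) from rfl]
      field_simp
    rw [h2, Complex.ofReal_re] at h1
    have h3 : ∀ i, a i * ‖star (y i) / α i‖ ^ 2 = ‖y i‖ ^ 2 := fun i => by
      rw [norm_div, div_pow, hαn, norm_star, mul_div_cancel₀ _ (ha i).ne']
    have h4 : ∀ j, b j * ‖v j / β j‖ ^ 2 = ‖v j‖ ^ 2 := fun j => by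
      rw [norm_div, div_pow, hβn, mul_div_cancel₀ _ (hb j).ne']
    simp only [h3, h4] at h1
    linarith
  have hXB : opNorm (Matrix.hadamard X B) ≤ 1 :=
    (opNorm_hadamard_le_schurNorm (by rw [hX]; exact one_ne_zero) hBn).trans_eq hX
  set w := Matrix.hadamard X B *ᵥ β with hw
  have hw1 : ∑ i, ‖w i‖ ^ 2 ≤ ∑ j, b j := by
    refine (sum_norm_mulVec_sq_le _ _).trans ?_
    simp only [hβn]
    exact mul_le_of_le_one_left (Finset.sum_nonneg fun j _ => (hb j).le)
      (pow_le_one₀ (opNorm_nonneg _) hXB)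
  have hsum : ∑ i, ∑ j, Y i j * X i j = ∑ i, 2 * (α i * w i) := by
    refine Finset.sum_congr rfl fun i _ => ?_
    simp only [hw, mulVec, dotProduct, hadamard_apply, hB, Finset.mul_sum]
    refine Finset.sum_congr rfl fun j _ => ?_
    have := hα0 i
    have := hβ0 j
    field_simp
  calc (∑ i, ∑ j, Y i j * X i j).re ≤ ‖∑ i, 2 * (α i * w i)‖ := by
        rw [hsum]; exact Complex.re_le_norm _
    _ ≤ ∑ i, (a i + ‖w i‖ ^ 2) := by
      refine norm_sum_le_of_le _ fun i _ => ?_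
      rw [← hαn, norm_mul, norm_mul, Complex.norm_ofNat]
      nlinarith [sq_nonneg (‖α i‖ - ‖w i‖)]
    _ ≤ _ := by rw [Finset.sum_add_distrib]; linarith

lemma re_pairing_le {m n : ℕ} {X Y : Matrix (Fin m) (Fin n) ℂ} (hX : schurNorm X = 1)
    {a : Fin m → ℝ} {b : Fin n → ℝ}
    (h : ∀ (u : Fin m → ℂ) (v : Fin n → ℂ), (∑ i, ∑ j, Y i j * (u i * v j)).re ≤
      ∑ i, a i * ‖u i‖ ^ 2 + ∑ j, b j * ‖v j‖ ^ 2) :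
    (∑ i, ∑ j, Y i j * X i j).re ≤ ∑ i, a i + ∑ j, b j := by
  have ha : ∀ i, 0 ≤ a i := fun i => by
    have := h (Pi.single i 1) 0
    simpa [Pi.single_apply, apply_ite] using this
  have hb : ∀ j, 0 ≤ b j := fun j => by
    have := h 0 (Pi.single j 1)
    simpa [Pi.single_apply, apply_ite] using this
  have key : ∀ ε : ℝ, 0 < ε →
      (∑ i, ∑ j, Y i j * X i j).re ≤ (∑ i, a i + ∑ j, b j) + ε * (m + n) := fun ε hε => by
    have := re_pairing_le_of_pos (a := fun i => a i + ε) (b := fun j => b j + ε) hX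
      (fun i => add_pos_of_nonneg_of_pos (ha i) hε) (fun j => add_pos_of_nonneg_of_pos (hb j) hε)
      (fun u v => (h u v).trans (by gcongr <;> linarith))
    simp only [Finset.sum_add_distrib, Finset.sum_const, Finset.card_univ, Fintype.card_fin,
      nsmul_eq_mul] at this
    linarith
  have hlim : Filter.Tendsto (fun ε : ℝ => (∑ i, a i + ∑ j, b j) + ε * (m + n))
      (nhdsWithin 0 (Set.Ioi 0)) (nhds ((∑ i, a i + ∑ j, b j) + 0 * (m + n))) :=
    (Continuous.tendsto (by fun_prop) 0).mono_left nhdsWithin_le_nhds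
  rw [zero_mul, add_zero] at hlim
  exact ge_of_tendsto hlim (Filter.eventually_of_mem self_mem_nhdsWithin key)

lemma conjTranspose_mul_self_diag {p q : Type*} [Fintype p] (B : Matrix p q ℂ) (k : q) :
    (Bᴴ * B) k k = ((∑ l, ‖B l k‖ ^ 2 : ℝ) : ℂ) := by
  rw [mul_apply]
  push_cast
  exact Finset.sum_congr rfl fun l _ => Complex.conj_mul' (B l k)

/-- The off-diagonal block and the diagonal of the Gram matrix of the columns of `B`. -/
def gramData {m n : ℕ} (B : Fin m ⊕ Fin n → Fin m ⊕ Fin n → ℂ) :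
    (Fin m → Fin n → ℂ) × (Fin m ⊕ Fin n → ℝ) :=
  (fun i j => ∑ l, star (B l (.inl i)) * B l (.inr j), fun k => ∑ l, ‖B l k‖ ^ 2)

lemma convex_gramData {m n : ℕ} (N : ℝ) :
    Convex ℝ (gramData (m := m) (n := n) '' {B | ∑ k, ∑ l, ‖B l k‖ ^ 2 = N}) := by
  rintro _ ⟨B, hB, rfl⟩ _ ⟨D, hD, rfl⟩ s t hs ht hst
  have hP : ((s : ℂ) • ((Matrix.of B)ᴴ * Matrix.of B)
      + (t : ℂ) • ((Matrix.of D)ᴴ * Matrix.of D)).PosSemidef :=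
    ((posSemidef_conjTranspose_mul_self _).smul (by exact_mod_cast hs)).add
      ((posSemidef_conjTranspose_mul_self _).smul (by exact_mod_cast ht))
  obtain ⟨R, hR⟩ : ∃ R : Matrix (Fin m ⊕ Fin n) (Fin m ⊕ Fin n) ℂ, Rᴴ * R =
      (s : ℂ) • ((Matrix.of B)ᴴ * Matrix.of B) + (t : ℂ) • ((Matrix.of D)ᴴ * Matrix.of D) := by
    open scoped MatrixOrder Matrix.Norms.L2Operator in
    obtain ⟨R, hR⟩ := CStarAlgebra.nonneg_iff_eq_star_mul_self.mp hP.nonneg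
    exact ⟨R, hR.symm⟩
  have hdiag : ∀ k, ∑ l, ‖R l k‖ ^ 2 = s * ∑ l, ‖B l k‖ ^ 2 + t * ∑ l, ‖D l k‖ ^ 2 := fun k => by
    have := congrFun (congrFun hR k) k
    rw [Matrix.add_apply, Matrix.smul_apply, Matrix.smul_apply] at this
    simp only [conjTranspose_mul_self_diag, smul_eq_mul, of_apply] at this
    exact_mod_cast this
  refine ⟨R, ?_, ?_⟩
  · change ∑ k, ∑ l, ‖B l k‖ ^ 2 = N at hB
    change ∑ k, ∑ l, ‖D l k‖ ^ 2 = N at hD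
    change ∑ k, ∑ l, ‖R l k‖ ^ 2 = N
    rw [Finset.sum_congr rfl fun k _ => hdiag k, Finset.sum_add_distrib, ← Finset.mul_sum,
      ← Finset.mul_sum, hB, hD, ← add_mul, hst, one_mul]
  · refine Prod.ext ?_ ?_
    · ext i j
      exact congrFun (congrFun hR (.inl i)) (.inr j)
    · ext k
      exact hdiag k

lemma isCompact_gramData {m n : ℕ} (N : ℝ) :
    IsCompact (gramData (m := m) (n := n) '' {B | ∑ k, ∑ l, ‖B l k‖ ^ 2 = N}) := by
  refine IsCompact.image (Metric.isCompact_of_isClosed_isBounded ?_ ?_) ?_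
  · exact isClosed_eq (by fun_prop) continuous_const
  · refine (Metric.isBounded_closedBall (x := 0) (r := Real.sqrt N)).subset fun B hB => ?_
    rw [mem_closedBall_zero_iff]
    refine (pi_norm_le_iff_of_nonneg (Real.sqrt_nonneg _)).2 fun l =>
      (pi_norm_le_iff_of_nonneg (Real.sqrt_nonneg _)).2 fun k => Real.le_sqrt_of_sq_le ?_
    rw [← hB]
    calc ‖B l k‖ ^ 2 ≤ ∑ l, ‖B l k‖ ^ 2 :=
          Finset.single_le_sum (f := fun l => ‖B l k‖ ^ 2) (fun _ _ => by positivity)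
            (Finset.mem_univ l)
      _ ≤ _ := Finset.single_le_sum (f := fun k => ∑ l, ‖B l k‖ ^ 2)
            (fun _ _ => by positivity) (Finset.mem_univ k)
  · unfold gramData
    fun_prop

lemma exists_functional_eq {m n : ℕ}
    (f : ((Fin m → Fin n → ℂ) × (Fin m ⊕ Fin n → ℝ)) →ₗ[ℝ] ℝ) :
    ∃ (Y : Matrix (Fin m) (Fin n) ℂ) (w : Fin m ⊕ Fin n → ℝ), ∀ Z d,
      f (Z, d) = (∑ i, ∑ j, Y i j * Z i j).re + ∑ k, w k * d k := by
  refine ⟨fun i j => (f ((Pi.single i (Pi.single j 1) : Fin m → Fin n → ℂ), 0) : ℂ)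
    - f ((Pi.single i (Pi.single j Complex.I) : Fin m → Fin n → ℂ), 0) * Complex.I,
    fun k => f (0, Pi.single k 1), fun Z d => ?_⟩
  have hd : d = ∑ k, d k • Pi.single k (1 : ℝ) := by
    ext k
    simp [Finset.sum_apply, Pi.single_apply]
  have hZ : Z = ∑ i, ∑ j, ((Z i j).re • (Pi.single i (Pi.single j (1 : ℂ)) : Fin m → Fin n → ℂ)
      + (Z i j).im • (Pi.single i (Pi.single j Complex.I) : Fin m → Fin n → ℂ)) := by
    ext i j
    simp only [Finset.sum_apply, Pi.add_apply, Pi.smul_apply]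
    rw [Finset.sum_eq_single i, Finset.sum_eq_single j]
    · simp [Complex.re_add_im]
    · intro b _ hb; simp [hb.symm]
    · simp
    · intro b _ hb; simp [hb.symm]
    · simp
  have h1 : f (Z, d) = (f ∘ₗ LinearMap.inl ℝ _ _) Z + (f ∘ₗ LinearMap.inr ℝ _ _) d := by
    simp [← map_add]
  rw [h1]
  congr 1
  · conv_lhs => rw [hZ]
    simp only [map_sum, map_add, map_smul, LinearMap.comp_apply, LinearMap.inl_apply,
      Complex.re_sum, smul_eq_mul]
    refine Finset.sum_congr rfl fun i _ => Finset.sum_congr rfl fun j _ => ?_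
    simp
    ring
  · conv_lhs => rw [hd]
    simp only [map_sum, map_smul, LinearMap.comp_apply, LinearMap.inr_apply, smul_eq_mul]
    exact Finset.sum_congr rfl fun k _ => mul_comm _ _

/-- A Schur contraction is a block of Gram entries of two families of unit vectors. -/
lemma exists_gramData_eq {m n : ℕ} {X : Matrix (Fin m) (Fin n) ℂ} (hX : schurNorm X = 1) :
    ∃ B, gramData B = (fun i j => X i j, fun _ => 1) := by
  by_contra hne
  set N : ℝ := m + n with hN
  have hmem : ((fun i j => X i j, fun _ => 1) : (Fin m → Fin n → ℂ) × (Fin m ⊕ Fin n → ℝ)) ∉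
      gramData '' {B | ∑ k, ∑ l, ‖B l k‖ ^ 2 = N} := fun ⟨B, _, hB⟩ => hne ⟨B, hB⟩
  obtain ⟨f, r, hf, hr⟩ := geometric_hahn_banach_closed_point (convex_gramData N)
    (isCompact_gramData N).isClosed hmem
  obtain ⟨Y, w, hYw⟩ := exists_functional_eq f.toLinearMap
  simp only [ContinuousLinearMap.coe_coe] at hYw
  rw [hYw] at hr
  have hNpos : 0 < N := by
    by_contra h0
    have hm : m = 0 := by
      by_contra hm
      have : (0 : ℝ) < m := by exact_mod_cast Nat.pos_of_ne_zero hm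
      have : (0 : ℝ) ≤ n := Nat.cast_nonneg n
      linarith
    have hn : n = 0 := by
      by_contra hn
      have : (0 : ℝ) < n := by exact_mod_cast Nat.pos_of_ne_zero hn
      have : (0 : ℝ) ≤ m := Nat.cast_nonneg m
      linarith
    subst hm hn
    exact hne ⟨0, Subsingleton.elim _ _⟩
  have hform : ∀ (u : Fin m → ℂ) (v : Fin n → ℂ), (∑ i, ∑ j, Y i j * (u i * v j)).re ≤
      ∑ i, (r / N - w (.inl i)) * ‖u i‖ ^ 2 + ∑ j, (r / N - w (.inr j)) * ‖v j‖ ^ 2 := by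
    intro u v
    set q : ℝ := ∑ i, ‖u i‖ ^ 2 + ∑ j, ‖v j‖ ^ 2 with hq
    have hu0 : 0 ≤ ∑ i, ‖u i‖ ^ 2 := Finset.sum_nonneg fun _ _ => by positivity
    have hv0 : 0 ≤ ∑ j, ‖v j‖ ^ 2 := Finset.sum_nonneg fun _ _ => by positivity
    rcases (add_nonneg hu0 hv0).eq_or_lt with h0 | hqpos
    · have hu : ∀ i, u i = 0 := fun i => by
        have := (Finset.sum_eq_zero_iff_of_nonneg (fun i _ => by positivity)).1
          (show ∑ i, ‖u i‖ ^ 2 = 0 by linarith) i (Finset.mem_univ i)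
        simpa using this
      have hv : ∀ j, v j = 0 := fun j => by
        have := (Finset.sum_eq_zero_iff_of_nonneg (fun j _ => by positivity)).1
          (show ∑ j, ‖v j‖ ^ 2 = 0 by linarith) j (Finset.mem_univ j)
        simpa using this
      simp [hu, hv]
    · set c : ℝ := Real.sqrt q⁻¹ with hc
      have hcc : c ^ 2 = q⁻¹ := Real.sq_sqrt (inv_nonneg.2 hqpos.le)
      have hcard : (Fintype.card (Fin m ⊕ Fin n) : ℝ) = N := by simp [hN]
      obtain ⟨B, hBl, hBr⟩ : ∃ B : Fin m ⊕ Fin n → Fin m ⊕ Fin n → ℂ,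
          (∀ l i, B l (.inl i) = c * star (u i)) ∧ ∀ l j, B l (.inr j) = c * v j :=
        ⟨fun _ => Sum.elim (fun i => c * star (u i)) (fun j => c * v j), fun _ _ => rfl,
          fun _ _ => rfl⟩
      have hdl : ∀ i, ∑ l, ‖B l (.inl i)‖ ^ 2 = N / q * ‖u i‖ ^ 2 := fun i => by
        simp only [hBl, norm_mul, norm_star, mul_pow, Complex.norm_real, Real.norm_eq_abs,
          sq_abs, hcc, Finset.sum_const, Finset.card_univ, nsmul_eq_mul, hcard]
        ring
      have hdr : ∀ j, ∑ l, ‖B l (.inr j)‖ ^ 2 = N / q * ‖v j‖ ^ 2 := fun j => by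
        simp only [hBr, norm_mul, mul_pow, Complex.norm_real, Real.norm_eq_abs,
          sq_abs, hcc, Finset.sum_const, Finset.card_univ, nsmul_eq_mul, hcard]
        ring
      have hoff : ∀ i j, ∑ l, star (B l (.inl i)) * B l (.inr j)
          = ((N / q : ℝ) : ℂ) * (u i * v j) := fun i j => by
        have hcc' : (c : ℂ) * c = (q : ℂ)⁻¹ := by
          rw [← Complex.ofReal_inv, ← hcc]; push_cast; ring
        have hcard' : (Fintype.card (Fin m ⊕ Fin n) : ℂ) = (N : ℂ) := by
          rw [← hcard]; simp
        simp only [hBl, hBr, star_mul', star_star, Finset.sum_const, Finset.card_univ,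
          nsmul_eq_mul, hcard']
        rw [show star (c : ℂ) = c from Complex.conj_ofReal c]
        push_cast
        rw [div_eq_mul_inv, ← hcc']
        ring
      have hB := hf (gramData B) ⟨B, by
        change ∑ k, ∑ l, ‖B l k‖ ^ 2 = N
        rw [Fintype.sum_sum_type]
        simp only [hdl, hdr, ← Finset.mul_sum]
        rw [← mul_add, ← hq, div_mul_cancel₀ _ hqpos.ne'], rfl⟩
      unfold gramData at hB
      rw [hYw, Fintype.sum_sum_type] at hB
      simp only [hdl, hdr, hoff] at hB
      have e1 : ∑ i, ∑ j, Y i j * (((N / q : ℝ) : ℂ) * (u i * v j))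
          = ((N / q : ℝ) : ℂ) * ∑ i, ∑ j, Y i j * (u i * v j) := by
        simp only [Finset.mul_sum]
        exact Finset.sum_congr rfl fun i _ => Finset.sum_congr rfl fun j _ => by ring
      have e2 : ∑ i, w (.inl i) * (N / q * ‖u i‖ ^ 2)
          = N / q * ∑ i, w (.inl i) * ‖u i‖ ^ 2 := by
        rw [Finset.mul_sum]
        exact Finset.sum_congr rfl fun i _ => by ring
      have e3 : ∑ j, w (.inr j) * (N / q * ‖v j‖ ^ 2)
          = N / q * ∑ j, w (.inr j) * ‖v j‖ ^ 2 := by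
        rw [Finset.mul_sum]
        exact Finset.sum_congr rfl fun j _ => by ring
      rw [e1, e2, e3, Complex.re_ofReal_mul] at hB
      simp only [sub_mul, Finset.sum_sub_distrib, ← Finset.mul_sum]
      have hq0 : q ≠ 0 := hqpos.ne'
      have h5 : N / q * (r / N * q) = r := by
        field_simp
      have h6 := lt_of_mul_lt_mul_left
        (show N / q * ((∑ i, ∑ j, Y i j * (u i * v j)).re
          + (∑ i, w (.inl i) * ‖u i‖ ^ 2 + ∑ j, w (.inr j) * ‖v j‖ ^ 2)) < N / q * (r / N * q) by
            rw [h5]; linarith) (div_pos hNpos hqpos).le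
      rw [hq] at h6
      linarith
  have := re_pairing_le hX hform
  simp only [Finset.sum_sub_distrib, Finset.sum_const, Finset.card_univ, Fintype.card_fin,
    nsmul_eq_mul] at this
  simp only [mul_one, Fintype.sum_sum_type] at hr
  have h2 : (m : ℝ) * (r / N) + n * (r / N) = r := by
    rw [← add_mul, ← hN, mul_div_cancel₀ _ hNpos.ne']
  linarith

theorem stmt11 {m n : ℕ} (X : Matrix (Fin m) (Fin n) ℂ) (hX : schurNorm X = 1) :
    ∃ (F : Matrix (Fin m) (Fin m) ℂ) (C : Matrix (Fin m) (Fin n) ℂ)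
      (G : Matrix (Fin n) (Fin n) ℂ),
      F.PosSemidef ∧ (∀ i, (F * F) i i = 1) ∧ G.PosSemidef ∧
      (∀ j, (G * G) j j = 1) ∧ opNorm C = 1 ∧ X = F * C * G := by
  obtain ⟨B, hB⟩ := exists_gramData_eq hX
  have hoff : ∀ i j, ∑ l, star (B l (.inl i)) * B l (.inr j) = X i j := fun i j =>
    congrFun (congrFun (congrArg Prod.fst hB) i) j
  have hdiag : ∀ k, ∑ l, ‖B l k‖ ^ 2 = 1 := fun k => congrFun (congrArg Prod.snd hB) k
  obtain ⟨F, C, G, hF, hFF, hG, hGG, hC, hfac⟩ := exists_factorization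
    (of fun l i => B l (.inl i)) (of fun l j => B l (.inr j))
  have hXfac : X = F * C * G := by
    rw [← hfac]
    ext i j
    rw [← hoff, mul_apply]
    rfl
  have hF1 : ∀ i, (F * F) i i = 1 := fun i => by
    rw [hFF, conjTranspose_mul_self_diag]
    simp only [of_apply, hdiag, Complex.ofReal_one]
  have hG1 : ∀ j, (G * G) j j = 1 := fun j => by
    rw [hGG, conjTranspose_mul_self_diag]
    simp only [of_apply, hdiag, Complex.ofReal_one]
  refine ⟨F, C, G, hF, hF1, hG, hG1, le_antisymm hC ?_, hXfac⟩
  rw [← hX]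
  refine Real.sSup_le ?_ (opNorm_nonneg C)
  rintro _ ⟨A, hA, rfl⟩
  rw [hXfac]
  refine (opNorm_hadamard_le (fun i => sum_norm_sq_row_of_mul_self hF.1 (hF1 i))
    (fun j => ?_) A).trans (mul_le_of_le_one_right (opNorm_nonneg C) hA)
  rw [← sum_norm_sq_row_of_mul_self hG.1 (hG1 j)]
  exact Finset.sum_congr rfl fun l _ => by rw [← hG.1.apply l j, norm_star]

end MatFact
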